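/- arXiv:1707.05751 — 13 statements merged into one kernel-verified Lean document; each statement's English description precedes it below -/
import Mathlib

section
/- For every real number x and all integers m and n with 1 ≤ m ≤ n, one has ∑_{k=m}^{n} C(k-1, m-1) · x^{m} · (1-x)^{k-m} = ∑_{k=m}^{n} C(n,k) · x^{k} · (1-x)^{n-k}. -/
lemma aux_tele (f : ℕ → ℝ) (p N : ℕ) (h : p ≤ N) :
    ∑ k ∈ Finset.Icc (p + 1) N, (f (k - 1) - f k) = f p - f N := by
  induction N, h using Nat.le_induction with
  | base => simp
  | succ N hN ih =>
    rw [Finset.sum_Icc_succ_top (by omega), ih]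
    simp

lemma aux_rec (x : ℝ) (n k : ℕ) (hk : 1 ≤ k) (hkn : k ≤ n + 1) :
    ((n + 1).choose k : ℝ) * x ^ k * (1 - x) ^ (n + 1 - k)
      = (n.choose k : ℝ) * x ^ k * (1 - x) ^ (n - k)
        + x * ((n.choose (k - 1) : ℝ) * x ^ (k - 1) * (1 - x) ^ (n - (k - 1))
          - (n.choose k : ℝ) * x ^ k * (1 - x) ^ (n - k)) := by
  obtain ⟨j, rfl⟩ : ∃ j, k = j + 1 := ⟨k - 1, by omega⟩
  rw [Nat.choose_succ_succ]
  rcases Nat.lt_or_ge j n with h | h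
  · obtain ⟨d, rfl⟩ : ∃ d, n = j + 1 + d := ⟨n - (j + 1), by omega⟩
    have e1 : j + 1 + d + 1 - (j + 1) = d + 1 := by omega
    have e2 : j + 1 + d - (j + 1) = d := by omega
    have e3 : j + 1 + d - (j + 1 - 1) = d + 1 := by omega
    rw [e1, e2, e3]
    simp only [Nat.add_sub_cancel, Nat.succ_eq_add_one]
    push_cast
    ring
  · obtain rfl : j = n := by omega
    simp
    ring

/-- Comtet's second exercise: for real `x` and integers `1 ≤ m ≤ n`,
`∑_{k=m}^{n} C(k-1,m-1) x^m (1-x)^{k-m} = ∑_{k=m}^{n} C(n,k) x^k (1-x)^{n-k}`. -/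
theorem stmt_1 (x : ℝ) (m n : ℕ) (hm : 1 ≤ m) (hmn : m ≤ n) :
    ∑ k ∈ Finset.Icc m n, ((k - 1).choose (m - 1) : ℝ) * x ^ m * (1 - x) ^ (k - m)
      = ∑ k ∈ Finset.Icc m n, (n.choose k : ℝ) * x ^ k * (1 - x) ^ (n - k) := by
  obtain ⟨p, rfl⟩ : ∃ p, m = p + 1 := ⟨m - 1, by omega⟩
  induction n, hmn using Nat.le_induction with
  | base => simp
  | succ n hn ih =>
    rw [Finset.sum_Icc_succ_top (by omega), ih]
    have h1 : ∀ k ∈ Finset.Icc (p + 1) (n + 1), _ := fun k hk =>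
      aux_rec x n k (by have := Finset.mem_Icc.1 hk; omega) (Finset.mem_Icc.1 hk).2
    rw [Finset.sum_congr rfl h1, Finset.sum_add_distrib, ← Finset.mul_sum,
      aux_tele (fun k => (n.choose k : ℝ) * x ^ k * (1 - x) ^ (n - k)) p (n + 1) (by omega),
      Finset.sum_Icc_succ_top (by omega)]
    have e : n + 1 - (p + 1) = n - p := by omega
    simp [e]
    ring
end

section
/- For every real number x, every integer N ≥ 0 and every integer m ≥ 1, one has ∑_{j=0}^{N} C(m-1+j, m-1) · (1-x)^{j} = ∑_{j=0}^{N} C(N+m, j) · x^{N-j} · (1-x)^{j}. -/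
theorem stmt_2_aux (x y : ℝ) (h : x + y = 1) (k N : ℕ) :
    ∑ j ∈ Finset.range (N + 1), ((k + j).choose k : ℝ) * y ^ j
      = ∑ j ∈ Finset.range (N + 1), ((N + (k + 1)).choose j : ℝ) * x ^ (N - j) * y ^ j := by
  induction N with
  | zero => simp
  | succ N ih =>
    rw [Finset.sum_range_succ, ih]
    have e1 : ∑ j ∈ Finset.range (N + 1 + 1),
          ((N + 1 + (k + 1)).choose j : ℝ) * x ^ (N + 1 - j) * y ^ j
        = y * ∑ j ∈ Finset.range (N + 1), ((N + (k + 1)).choose j : ℝ) * x ^ (N - j) * y ^ j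
          + ∑ j ∈ Finset.range (N + 1 + 1),
            ((N + (k + 1)).choose j : ℝ) * x ^ (N + 1 - j) * y ^ j := by
      rw [Finset.sum_range_succ', Finset.sum_range_succ' _ (N + 1), Finset.mul_sum,
        ← add_assoc (Finset.sum _ _), ← Finset.sum_add_distrib]
      congr 1
      · refine Finset.sum_congr rfl fun j _ => ?_
        rw [show N + 1 + (k + 1) = (N + (k + 1)) + 1 by ring, Nat.choose_succ_succ',
          Nat.add_sub_add_right]
        push_cast
        ring
    have e2 : ∑ j ∈ Finset.range (N + 1),
          ((N + (k + 1)).choose j : ℝ) * x ^ (N + 1 - j) * y ^ j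
        = x * ∑ j ∈ Finset.range (N + 1),
          ((N + (k + 1)).choose j : ℝ) * x ^ (N - j) * y ^ j := by
      rw [Finset.mul_sum]
      refine Finset.sum_congr rfl fun j hj => ?_
      have hj' : j ≤ N := by simpa [Nat.lt_succ_iff] using hj
      rw [Nat.succ_sub hj', pow_succ]
      ring
    have e3 : (N + (k + 1)).choose (N + 1) = (k + (N + 1)).choose k := by
      rw [show N + (k + 1) = k + (N + 1) by ring, Nat.choose_symm_add]
    rw [e1, Finset.sum_range_succ _ (N + 1), e2, e3, Nat.sub_self, pow_zero]
    obtain rfl : x = 1 - y := by linarith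
    ring

/-- For real `x`, `N ≥ 0` and `m ≥ 1`,
`∑_{j=0}^{N} C(m-1+j,m-1) (1-x)^j = ∑_{j=0}^{N} C(N+m,j) x^{N-j} (1-x)^j`. -/
theorem stmt_2 (x : ℝ) (N m : ℕ) (hm : 1 ≤ m) :
    ∑ j ∈ Finset.range (N + 1), ((m - 1 + j).choose (m - 1) : ℝ) * (1 - x) ^ j
      = ∑ j ∈ Finset.range (N + 1), ((N + m).choose j : ℝ) * x ^ (N - j) * (1 - x) ^ j := by
  obtain ⟨k, rfl⟩ : ∃ k, m = k + 1 := ⟨m - 1, by omega⟩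
  exact stmt_2_aux x (1 - x) (by ring) k N
end

section
/- For every integer n ≥ 0, one has ∑_{j=0}^{n} 2^{j} · C(3n+1, n-j) = (n+1) · C(3n+1, 2n) · ∫_{0}^{1} (3-2x)^{n} x^{2n} dx. -/
lemma beta_aux (k : ℕ) : ∀ m : ℕ, ∫ x in (0 : ℝ)..1, (1 - x) ^ k * x ^ m
    = (k.factorial : ℝ) * m.factorial / (m + k + 1).factorial := by
  induction k with
  | zero =>
    intro m
    have h : (m.factorial : ℝ) ≠ 0 := by positivity
    have h2 : (m : ℝ) + 1 ≠ 0 := by positivity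
    simp [Nat.factorial_succ]
    field_simp
  | succ k ih =>
    intro m
    have e : ∀ x : ℝ, (1 - x) ^ (k + 1) * x ^ m
        = (1 - x) ^ k * x ^ m - (1 - x) ^ k * x ^ (m + 1) := by
      intro x; ring
    simp_rw [e]
    rw [intervalIntegral.integral_sub
      (Continuous.intervalIntegrable (by fun_prop) _ _)
      (Continuous.intervalIntegrable (by fun_prop) _ _), ih, ih]
    rw [show m + 1 + k + 1 = (m + k + 1) + 1 by ring,
      show m + (k + 1) + 1 = (m + k + 1) + 1 by ring,
      Nat.factorial_succ (m + k + 1), Nat.factorial_succ m, Nat.factorial_succ k]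
    have h : ((m + k + 1).factorial : ℝ) ≠ 0 := by positivity
    have h2 : (m : ℝ) + k + 1 + 1 ≠ 0 := by positivity
    push_cast
    field_simp
    ring

/-- For every `n ≥ 0`,
`∑_{j=0}^{n} 2^j C(3n+1, n-j) = (n+1) C(3n+1, 2n) ∫_0^1 (3-2x)^n x^{2n} dx`. -/
theorem stmt_3 (n : ℕ) :
    ∑ j ∈ Finset.range (n + 1), (2 : ℝ) ^ j * ((3 * n + 1).choose (n - j) : ℝ)
      = ((n : ℝ) + 1) * ((3 * n + 1).choose (2 * n) : ℝ) *
        ∫ x in (0 : ℝ)..1, (3 - 2 * x) ^ n * x ^ (2 * n) := by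
  have e : ∀ x : ℝ, (3 - 2 * x) ^ n * x ^ (2 * n) = ∑ j ∈ Finset.range (n + 1),
      ((2 : ℝ) ^ j * (n.choose j : ℝ)) * ((1 - x) ^ j * x ^ (2 * n)) := by
    intro x
    rw [show 3 - 2 * x = 2 * (1 - x) + 1 by ring, add_pow, Finset.sum_mul]
    refine Finset.sum_congr rfl fun j _ => ?_
    rw [mul_pow, one_pow]
    ring
  simp_rw [e]
  rw [intervalIntegral.integral_finsetSum
    (fun j _ => Continuous.intervalIntegrable (by fun_prop) _ _), Finset.mul_sum]
  refine Finset.sum_congr rfl fun j hj => ?_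
  have hj : j ≤ n := by simpa [Nat.lt_succ_iff] using hj
  rw [intervalIntegral.integral_const_mul, beta_aux,
    Nat.cast_choose ℝ (show n - j ≤ 3 * n + 1 by omega),
    Nat.cast_choose ℝ (show 2 * n ≤ 3 * n + 1 by omega), Nat.cast_choose ℝ hj,
    show 3 * n + 1 - (n - j) = 2 * n + j + 1 by omega,
    show 3 * n + 1 - 2 * n = n + 1 by omega, Nat.factorial_succ n]
  have h1 : (n.factorial : ℝ) ≠ 0 := by positivity
  have h2 : (j.factorial : ℝ) ≠ 0 := by positivity
  have h3 : ((2 * n).factorial : ℝ) ≠ 0 := by positivity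
  have h4 : ((n - j).factorial : ℝ) ≠ 0 := by positivity
  have h5 : ((2 * n + j + 1).factorial : ℝ) ≠ 0 := by positivity
  have h6 : (n : ℝ) + 1 ≠ 0 := by positivity
  push_cast
  field_simp
end

section
/- For every integer n ≥ 0, one has ∑_{j=0}^{2n} (-4)^{j} · C(3n+1, n+1+j) = (1/2) · (n+1) · C(3n+1, 2n) · ∫_{-1/2}^{3/2} (3-2x)^{n} x^{2n} dx, where the sum is interpreted as a sum of integers (or rationals) and the right-hand side is a real number. -/
lemma aux_int (a b : ℕ) :
    ((b : ℝ) + 1) * (∫ x in (-(1 / 2) : ℝ)..(3 / 2), (3 - 2 * x) ^ (a + 1) * x ^ b)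
      = 2 * ((a : ℝ) + 1) * (∫ x in (-(1 / 2) : ℝ)..(3 / 2), (3 - 2 * x) ^ a * x ^ (b + 1))
        - 4 ^ (a + 1) * (-(1 / 2)) ^ (b + 1) := by
  have h := intervalIntegral.integral_eq_sub_of_hasDerivAt
    (f := fun x : ℝ => (3 - 2 * x) ^ (a + 1) * x ^ (b + 1))
    (f' := fun x : ℝ => ((b : ℝ) + 1) * ((3 - 2 * x) ^ (a + 1) * x ^ b)
      - 2 * ((a : ℝ) + 1) * ((3 - 2 * x) ^ a * x ^ (b + 1)))
    (a := -(1 / 2)) (b := 3 / 2)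
    (by
      intro x _
      have h1 : HasDerivAt (fun x : ℝ => 3 - 2 * x) (-2) x := by
        simpa using ((hasDerivAt_id x).const_mul (2 : ℝ)).const_sub 3
      have h2 := (h1.pow (a + 1)).mul (hasDerivAt_pow (b + 1) x)
      refine HasDerivAt.congr_deriv (f := fun x : ℝ => (3 - 2 * x) ^ (a + 1) * x ^ (b + 1)) h2 ?_
      simp only [Nat.add_sub_cancel, Pi.pow_apply]
      push_cast
      ring)
    (Continuous.intervalIntegrable (by fun_prop) _ _)
  rw [intervalIntegral.integral_sub (Continuous.intervalIntegrable (by fun_prop) _ _)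
    (Continuous.intervalIntegrable (by fun_prop) _ _),
    intervalIntegral.integral_const_mul, intervalIntegral.integral_const_mul] at h
  have e1 : (3 - 2 * (3 / 2) : ℝ) = 0 := by norm_num
  have e2 : (3 - 2 * (-(1 / 2)) : ℝ) = 4 := by norm_num
  simp only [e1, e2, zero_pow (Nat.succ_ne_zero a)] at h
  linarith

lemma aux_main (a : ℕ) : ∀ b : ℕ,
    2 * 4 ^ a * ∑ j ∈ Finset.range (b + 1), (-4 : ℝ) ^ j * ((a + b + 1).choose (a + 1 + j) : ℝ)
      = (-2) ^ b * ((a : ℝ) + 1) * ((a + b + 1).choose (a + 1) : ℝ) *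
        ∫ x in (-(1 / 2) : ℝ)..(3 / 2), (3 - 2 * x) ^ a * x ^ b := by
  induction a with
  | zero =>
    intro b
    have hb : ((b : ℝ) + 1) ≠ 0 := by positivity
    have h := add_pow (-4 : ℝ) 1 (b + 1)
    rw [Finset.sum_range_succ'] at h
    simp only [one_pow, mul_one, pow_zero, Nat.choose_zero_right, Nat.cast_one] at h
    have h3 : ∑ j ∈ Finset.range (b + 1), (-4 : ℝ) ^ (j + 1) * ((b + 1).choose (j + 1) : ℝ)
        = (-4) * ∑ j ∈ Finset.range (b + 1),
          (-4 : ℝ) ^ j * ((0 + b + 1).choose (0 + 1 + j) : ℝ) := by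
      rw [Finset.mul_sum]
      refine Finset.sum_congr rfl fun j _ => ?_
      rw [Nat.zero_add, Nat.zero_add, Nat.add_comm 1 j]
      ring
    rw [h3] at h
    have p1 : (-2 : ℝ) ^ (b + 1) * (3 / 2) ^ (b + 1) = (-3) ^ (b + 1) := by
      rw [← mul_pow]; norm_num
    have p2 : (-2 : ℝ) ^ (b + 1) * (-(1 / 2)) ^ (b + 1) = 1 := by
      rw [← mul_pow]; norm_num
    have p3 : (-4 + 1 : ℝ) = -3 := by norm_num
    rw [p3] at h
    simp only [pow_zero, one_mul, integral_pow, zero_add, Nat.choose_one_right, Nat.cast_zero] at h ⊢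
    push_cast
    field_simp
    rw [pow_succ (-2 : ℝ) b] at p1 p2
    linarith
  | succ a ih =>
    intro b
    have h := ih (b + 1)
    rw [Finset.sum_range_succ'] at h
    have e : a + 1 + b + 1 = a + (b + 1) + 1 := by ring
    rw [e]
    have h3 : ∑ j ∈ Finset.range (b + 1),
          (-4 : ℝ) ^ (j + 1) * ((a + (b + 1) + 1).choose (a + 1 + (j + 1)) : ℝ)
        = (-4) * ∑ j ∈ Finset.range (b + 1),
          (-4 : ℝ) ^ j * ((a + (b + 1) + 1).choose (a + 1 + 1 + j) : ℝ) := by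
      rw [Finset.mul_sum]
      refine Finset.sum_congr rfl fun j _ => ?_
      rw [show a + 1 + (j + 1) = a + 1 + 1 + j by ring]
      ring
    rw [h3] at h
    have hc := Nat.choose_succ_right_eq (a + (b + 1) + 1) (a + 1)
    rw [show a + (b + 1) + 1 - (a + 1) = b + 1 by omega] at hc
    have hc' : ((a + (b + 1) + 1).choose (a + 1 + 1) : ℝ) * ((a : ℝ) + 1 + 1)
        = ((a + (b + 1) + 1).choose (a + 1) : ℝ) * ((b : ℝ) + 1) := by exact_mod_cast hc
    have hi := aux_int a b
    have p2 : (-2 : ℝ) ^ (b + 1) * (-(1 / 2)) ^ (b + 1) = 1 := by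
      rw [← mul_pow]; norm_num
    simp only [pow_zero, one_mul, add_zero] at h
    push_cast
    generalize (∑ j ∈ Finset.range (b + 1),
          (-4 : ℝ) ^ j * ((a + (b + 1) + 1).choose (a + 1 + 1 + j) : ℝ)) = S at *
    generalize ((a + (b + 1) + 1).choose (a + 1 + 1) : ℝ) = C2 at *
    generalize ((a + (b + 1) + 1).choose (a + 1) : ℝ) = C1 at *
    generalize (∫ x in (-(1 / 2) : ℝ)..(3 / 2), (3 - 2 * x) ^ (a + 1) * x ^ b) = I2 at *
    generalize (∫ x in (-(1 / 2) : ℝ)..(3 / 2), (3 - 2 * x) ^ a * x ^ (b + 1)) = I1 at *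
    generalize (-(1 / 2) : ℝ) ^ (b + 1) = q at *
    rw [pow_succ (-2 : ℝ) b] at h p2
    rw [pow_succ (4 : ℝ) a] at hi ⊢
    generalize (-2 : ℝ) ^ b = p at *
    generalize (4 : ℝ) ^ a = f at *
    linear_combination (-1) * h - p * I2 * hc' - p * C1 * hi - 2 * f * C1 * p2

/-- For every `n ≥ 0`,
`∑_{j=0}^{2n} (-4)^j C(3n+1, n+1+j)
  = (1/2) (n+1) C(3n+1, 2n) ∫_{-1/2}^{3/2} (3-2x)^n x^{2n} dx`. -/
theorem stmt_4 (n : ℕ) :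
    ∑ j ∈ Finset.range (2 * n + 1), (-4 : ℝ) ^ j * ((3 * n + 1).choose (n + 1 + j) : ℝ)
      = (1 / 2) * ((n : ℝ) + 1) * ((3 * n + 1).choose (2 * n) : ℝ) *
        ∫ x in (-(1 / 2) : ℝ)..(3 / 2), (3 - 2 * x) ^ n * x ^ (2 * n) := by
  have h := aux_main n (2 * n)
  rw [show n + 2 * n + 1 = 3 * n + 1 by ring, pow_mul (-2 : ℝ) 2 n,
    show ((-2 : ℝ) ^ 2) = 4 by norm_num,
    ← Nat.choose_symm_of_eq_add (show 3 * n + 1 = 2 * n + (n + 1) by ring)] at h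
  have h4 : (4 : ℝ) ^ n ≠ 0 := by positivity
  apply mul_left_cancel₀ h4
  linear_combination (1 / 2) * h
end

section
/- For every real number x and every integer n ≥ 0, one has ∑_{j=0}^{n} C(3n-j, 2n) · (1-x)^{n-j} = ∑_{j=0}^{n} C(3n+1, n-j) · x^{j} · (1-x)^{n-j}. -/
theorem aux_R (x y : ℝ) (N n : ℕ) :
    ∑ i ∈ Finset.range (n + 2), ((N + 1).choose i : ℝ) * x ^ (n + 1 - i) * y ^ i
      = (x + y) * ∑ i ∈ Finset.range (n + 1), (N.choose i : ℝ) * x ^ (n - i) * y ^ i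
        + (N.choose (n + 1) : ℝ) * y ^ (n + 1) := by
  have h1 : ∑ i ∈ Finset.range (n + 2), (N.choose i : ℝ) * x ^ (n + 1 - i) * y ^ i
      = x * ∑ i ∈ Finset.range (n + 1), (N.choose i : ℝ) * x ^ (n - i) * y ^ i
        + (N.choose (n + 1) : ℝ) * y ^ (n + 1) := by
    rw [Finset.sum_range_succ, Finset.mul_sum]
    congr 1
    · refine Finset.sum_congr rfl fun i hi => ?_
      have : n + 1 - i = (n - i) + 1 := by
        have := Finset.mem_range.1 hi
        omega
      rw [this, pow_succ]
      ring
    · simp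
  rw [Finset.sum_range_succ'] at h1 ⊢
  have h2 : ∑ i ∈ Finset.range (n + 1),
        ((N + 1).choose (i + 1) : ℝ) * x ^ (n + 1 - (i + 1)) * y ^ (i + 1)
      = y * ∑ i ∈ Finset.range (n + 1), (N.choose i : ℝ) * x ^ (n - i) * y ^ i
        + ∑ i ∈ Finset.range (n + 1),
          (N.choose (i + 1) : ℝ) * x ^ (n + 1 - (i + 1)) * y ^ (i + 1) := by
    rw [Finset.mul_sum, ← Finset.sum_add_distrib]
    refine Finset.sum_congr rfl fun i _ => ?_
    rw [Nat.choose_succ_succ, Nat.add_sub_add_right]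
    push_cast
    ring
  rw [h2]
  simp only [Nat.choose_zero_right] at h1 ⊢
  linarith

theorem aux_L (x : ℝ) (m n : ℕ) :
    ∑ i ∈ Finset.range (n + 1), ((m + i).choose m : ℝ) * (1 - x) ^ i
      = ∑ i ∈ Finset.range (n + 1), ((m + n + 1).choose i : ℝ) * x ^ (n - i) * (1 - x) ^ i := by
  induction n with
  | zero => simp
  | succ n ih =>
    rw [Finset.sum_range_succ, ih, ← add_assoc m n 1, aux_R x (1 - x) (m + n + 1) n,
      add_sub_cancel, one_mul]
    have : (m + n + 1).choose m = (m + n + 1).choose (n + 1) :=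
      Nat.choose_symm_of_eq_add (by omega)
    rw [this]

/-- For every real `x` and `n ≥ 0`,
`∑_{j=0}^{n} C(3n-j, 2n) (1-x)^{n-j} = ∑_{j=0}^{n} C(3n+1, n-j) x^j (1-x)^{n-j}`. -/
theorem stmt_5 (x : ℝ) (n : ℕ) :
    ∑ j ∈ Finset.range (n + 1), ((3 * n - j).choose (2 * n) : ℝ) * (1 - x) ^ (n - j)
      = ∑ j ∈ Finset.range (n + 1), ((3 * n + 1).choose (n - j) : ℝ) * x ^ j * (1 - x) ^ (n - j) := by
  have h := aux_L x (2 * n) n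
  rw [← Finset.sum_range_reflect, ← Finset.sum_range_reflect (fun i =>
    ((2 * n + n + 1).choose i : ℝ) * x ^ (n - i) * (1 - x) ^ i)] at h
  convert h using 1
  · refine Finset.sum_congr rfl fun j hj => ?_
    have := Finset.mem_range.1 hj
    rw [show n + 1 - 1 - j = n - j by omega, show 2 * n + (n - j) = 3 * n - j by omega]
  · refine Finset.sum_congr rfl fun j hj => ?_
    have := Finset.mem_range.1 hj
    rw [show n + 1 - 1 - j = n - j by omega, show n - (n - j) = j by omega,
      show 2 * n + n + 1 = 3 * n + 1 by omega]
end

section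
/- For every real number x and every integer n ≥ 0, one has ∑_{j=0}^{2n} C(3n-j, n) · (1-x)^{2n-j} = ∑_{k=0}^{2n} C(3n+1, n+1+k) · x^{k} · (1-x)^{2n-k}. -/
theorem stmt_6_aux (x : ℝ) (n m : ℕ) :
    ∑ i ∈ Finset.range (m + 1), ((n + i).choose n : ℝ) * (1 - x) ^ i
      = ∑ k ∈ Finset.range (m + 1),
          ((n + m + 1).choose (n + 1 + k) : ℝ) * x ^ k * (1 - x) ^ (m - k) := by
  induction m with
  | zero => simp
  | succ m ih =>
    rw [Finset.sum_range_succ, ih]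
    have h1 : ∀ k ∈ Finset.range (m + 1 + 1),
        ((n + (m + 1) + 1).choose (n + 1 + k) : ℝ) * x ^ k * (1 - x) ^ (m + 1 - k)
        = ((n + m + 1).choose (n + k) : ℝ) * x ^ k * (1 - x) ^ (m + 1 - k)
          + ((n + m + 1).choose (n + 1 + k) : ℝ) * x ^ k * (1 - x) ^ (m + 1 - k) := by
      intro k _
      have : (n + (m + 1) + 1).choose (n + 1 + k)
          = (n + m + 1).choose (n + k) + (n + m + 1).choose (n + 1 + k) := by
        rw [show n + 1 + k = (n + k) + 1 by ring, show n + (m + 1) + 1 = (n + m + 1) + 1 by ring,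
          Nat.choose_succ_succ']
      rw [this]
      push_cast
      ring
    rw [Finset.sum_congr rfl h1, Finset.sum_add_distrib]
    have h2 : ∑ k ∈ Finset.range (m + 1 + 1),
        ((n + m + 1).choose (n + 1 + k) : ℝ) * x ^ k * (1 - x) ^ (m + 1 - k)
        = (1 - x) * ∑ k ∈ Finset.range (m + 1),
          ((n + m + 1).choose (n + 1 + k) : ℝ) * x ^ k * (1 - x) ^ (m - k) := by
      rw [Finset.sum_range_succ, Nat.choose_eq_zero_of_lt (by omega), Finset.mul_sum]
      simp only [Nat.cast_zero, zero_mul, add_zero]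
      refine Finset.sum_congr rfl fun k hk => ?_
      rw [Finset.mem_range] at hk
      rw [show m + 1 - k = (m - k) + 1 by omega, pow_succ]
      ring
    have h3 : ∑ k ∈ Finset.range (m + 1),
        ((n + m + 1).choose (n + (k + 1)) : ℝ) * x ^ (k + 1) * (1 - x) ^ (m + 1 - (k + 1))
        = x * ∑ k ∈ Finset.range (m + 1),
          ((n + m + 1).choose (n + 1 + k) : ℝ) * x ^ k * (1 - x) ^ (m - k) := by
      rw [Finset.mul_sum]
      refine Finset.sum_congr rfl fun k _ => ?_
      rw [show m + 1 - (k + 1) = m - k by omega, show n + (k + 1) = n + 1 + k by ring, pow_succ]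
      ring
    rw [h2, Finset.sum_range_succ' _ (m + 1), h3]
    simp only [add_zero, pow_zero, mul_one, Nat.sub_zero, ← add_assoc]
    ring


/-- For every real `x` and `n ≥ 0`,
`∑_{j=0}^{2n} C(3n-j, n) (1-x)^{2n-j} = ∑_{k=0}^{2n} C(3n+1, n+1+k) x^k (1-x)^{2n-k}`. -/
theorem stmt_6 (x : ℝ) (n : ℕ) :
    ∑ j ∈ Finset.range (2 * n + 1), ((3 * n - j).choose n : ℝ) * (1 - x) ^ (2 * n - j)
      = ∑ k ∈ Finset.range (2 * n + 1),
          ((3 * n + 1).choose (n + 1 + k) : ℝ) * x ^ k * (1 - x) ^ (2 * n - k) := by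
  have h := stmt_6_aux x n (2 * n)
  rw [show n + 2 * n + 1 = 3 * n + 1 by ring] at h
  rw [← h, ← Finset.sum_range_reflect]
  refine Finset.sum_congr rfl fun j hj => ?_
  rw [Finset.mem_range] at hj
  rw [show 3 * n - (2 * n + 1 - 1 - j) = n + j by omega,
    show 2 * n - (2 * n + 1 - 1 - j) = j by omega]
end

section
/- Let f : ℝ → ℝ be continuous on the interval [-1/2, 3/2]. Then ∫_{-1/2}^{3/2} f(3x² - 2x³) dx = 2 · ∫_{0}^{1} f(3x² - 2x³) dx. -/
open Real in
theorem kr_aux (F : ℝ → ℝ) (hF : Continuous F) :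
    ∫ x in (-(1 / 2) : ℝ)..(3 / 2), F (3 * x ^ 2 - 2 * x ^ 3)
      = 2 * ∫ x in (0 : ℝ)..1, F (3 * x ^ 2 - 2 * x ^ 3) := by
  have hG : Continuous (fun x : ℝ => F (3 * x ^ 2 - 2 * x ^ 3)) := by fun_prop
  have hp : ∀ t : ℝ, 3 * (1 / 2 + cos t) ^ 2 - 2 * (1 / 2 + cos t) ^ 3 = 1 / 2 - cos (3 * t) / 2 := by
    intro t
    rw [cos_three_mul]; ring
  have key : ∀ a b : ℝ, ∫ x in (1 / 2 + cos a)..(1 / 2 + cos b), F (3 * x ^ 2 - 2 * x ^ 3)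
      = ∫ t in a..b, F (1 / 2 - cos (3 * t) / 2) * (-sin t) := by
    intro a b
    rw [← intervalIntegral.integral_comp_mul_deriv (f := fun t => 1 / 2 + cos t)
      (f' := fun t => -sin t) (g := fun x : ℝ => F (3 * x ^ 2 - 2 * x ^ 3))
      (fun x _ => (hasDerivAt_cos x).const_add _) (by fun_prop) hG]
    simp only [Function.comp_def, hp]
  have c1 : cos (2 * π / 3) = -(1 / 2) := by
    rw [show 2 * π / 3 = π - π / 3 by ring, cos_pi_sub, cos_pi_div_three]
  have s1 : sin (2 * π / 3) = √3 / 2 := by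
    rw [show 2 * π / 3 = π - π / 3 by ring, sin_pi_sub, sin_pi_div_three]
  have A := key (π / 3) 0
  have B := key (2 * π / 3) (π / 3)
  have C := key π (2 * π / 3)
  rw [cos_pi_div_three, cos_zero] at A
  rw [cos_pi_div_three, c1] at B
  rw [cos_pi, c1] at C
  have B' : ∫ t in (2 * π / 3)..(π / 3), F (1 / 2 - cos (3 * t) / 2) * (-sin t)
      = ∫ t in (0 : ℝ)..(π / 3), F (1 / 2 - cos (3 * t) / 2) * sin (2 * π / 3 - t) := by
    have h := intervalIntegral.integral_comp_sub_left (a := 0) (b := π / 3)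
      (fun t => F (1 / 2 - cos (3 * t) / 2) * sin t) (2 * π / 3)
    rw [show 2 * π / 3 - π / 3 = π / 3 by ring, sub_zero] at h
    rw [intervalIntegral.integral_symm]
    simp only [mul_neg, intervalIntegral.integral_neg, neg_neg]
    rw [← h]
    congr 1; ext t
    rw [show 3 * (2 * π / 3 - t) = 2 * π - 3 * t by ring, cos_two_pi_sub]
  have C' : ∫ t in π..(2 * π / 3), F (1 / 2 - cos (3 * t) / 2) * (-sin t)
      = ∫ t in (0 : ℝ)..(π / 3), F (1 / 2 - cos (3 * t) / 2) * sin (t + 2 * π / 3) := by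
    have h := intervalIntegral.integral_comp_add_right (a := 0) (b := π / 3)
      (fun t => F (1 / 2 - cos (3 * t) / 2) * sin t) (2 * π / 3)
    rw [show π / 3 + 2 * π / 3 = π by ring, zero_add] at h
    rw [intervalIntegral.integral_symm]
    simp only [mul_neg, intervalIntegral.integral_neg, neg_neg]
    rw [← h]
    congr 1; ext t
    rw [show 3 * (t + 2 * π / 3) = 3 * t + 2 * π by ring, cos_add_two_pi]
  have A' : ∫ t in (π / 3)..0, F (1 / 2 - cos (3 * t) / 2) * (-sin t)
      = ∫ t in (0 : ℝ)..(π / 3), F (1 / 2 - cos (3 * t) / 2) * sin t := by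
    rw [intervalIntegral.integral_symm]
    simp only [mul_neg, intervalIntegral.integral_neg, neg_neg]
  have S : (∫ t in (0 : ℝ)..(π / 3), F (1 / 2 - cos (3 * t) / 2) * sin t)
      + (∫ t in (0 : ℝ)..(π / 3), F (1 / 2 - cos (3 * t) / 2) * sin (t + 2 * π / 3))
      = ∫ t in (0 : ℝ)..(π / 3), F (1 / 2 - cos (3 * t) / 2) * sin (2 * π / 3 - t) := by
    rw [← intervalIntegral.integral_add (Continuous.intervalIntegrable (by fun_prop) _ _)
      (Continuous.intervalIntegrable (by fun_prop) _ _)]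
    congr 1; ext t
    rw [sin_add, sin_sub, c1, s1]; ring
  rw [A'] at A
  rw [B'] at B
  rw [C'] at C
  norm_num at A B C ⊢
  rw [← intervalIntegral.integral_add_adjacent_intervals (b := 0)
      (hG.intervalIntegrable _ _) (hG.intervalIntegrable _ _),
    ← intervalIntegral.integral_add_adjacent_intervals (a := 0) (b := 1)
      (hG.intervalIntegrable _ _) (hG.intervalIntegrable _ _)]
  norm_num at S
  linarith

/-- Kimura–Ruehr identity: if `f` is continuous on `[-1/2, 3/2]`, then
`∫_{-1/2}^{3/2} f(3x² - 2x³) dx = 2 ∫_0^1 f(3x² - 2x³) dx`. -/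
theorem stmt_7 (f : ℝ → ℝ) (hf : ContinuousOn f (Set.Icc (-(1 / 2) : ℝ) (3 / 2))) :
    ∫ x in (-(1 / 2) : ℝ)..(3 / 2), f (3 * x ^ 2 - 2 * x ^ 3)
      = 2 * ∫ x in (0 : ℝ)..1, f (3 * x ^ 2 - 2 * x ^ 3) := by
  have hle : (-(1 / 2) : ℝ) ≤ 3 / 2 := by norm_num
  have hF : Continuous (Set.IccExtend hle ((Set.Icc (-(1 / 2) : ℝ) (3 / 2)).restrict f)) :=
    (continuousOn_iff_continuous_restrict.1 hf).Icc_extend'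
  have hm : ∀ x : ℝ, -(1 / 2) ≤ x → x ≤ 3 / 2 →
      f (3 * x ^ 2 - 2 * x ^ 3) = Set.IccExtend hle
        ((Set.Icc (-(1 / 2) : ℝ) (3 / 2)).restrict f) (3 * x ^ 2 - 2 * x ^ 3) := by
    intro x h1 h2
    rw [Set.IccExtend_of_mem]
    · rfl
    · constructor
      · nlinarith [mul_nonneg (sq_nonneg x) (by linarith : 0 ≤ 3 - 2 * x)]
      · nlinarith [mul_nonneg (sq_nonneg (x - 1)) (by linarith : 0 ≤ 2 * x + 1)]
  have h := kr_aux _ hF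
  rw [intervalIntegral.integral_congr (a := -(1 / 2)) (b := 3 / 2) (fun x hx => ?_),
    intervalIntegral.integral_congr (a := 0) (b := 1) (fun x hx => ?_)]
  · exact h
  · rw [Set.uIcc_of_le zero_le_one] at hx
    exact hm x (by linarith [hx.1]) (by linarith [hx.2])
  · rw [Set.uIcc_of_le hle] at hx
    exact hm x hx.1 hx.2
end

section
/- For every integer n ≥ 0, the following four integers are all equal: ∑_{j=0}^{n} 3^{j} · C(3n-j, 2n), ∑_{j=0}^{n} 2^{j} · C(3n+1, n-j), ∑_{j=0}^{2n} (-4)^{j} · C(3n+1, n+1+j), and ∑_{j=0}^{2n} (-3)^{j} · C(3n-j, n). -/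
def auxF (t : ℤ) (N n : ℕ) : ℤ := ∑ j ∈ Finset.range (n + 1), t ^ j * (N.choose (n - j) : ℤ)

theorem auxF_zero (t : ℤ) (N : ℕ) : auxF t N 0 = 1 := by simp [auxF]

theorem auxF_succ (t : ℤ) (N n : ℕ) :
    auxF t N (n + 1) = t * auxF t N n + (N.choose (n + 1) : ℤ) := by
  unfold auxF
  rw [Finset.sum_range_succ', Finset.mul_sum]
  congr 1
  · apply Finset.sum_congr rfl
    intro j _
    rw [show n + 1 - (j + 1) = n - j by omega]
    ring
  · simp

theorem auxF_pascal (t : ℤ) (N n : ℕ) :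
    auxF t (N + 1) (n + 1) = (1 + t) * auxF t N n + (N.choose (n + 1) : ℤ) := by
  induction n with
  | zero => simp [auxF_succ, auxF_zero]; ring
  | succ n ih =>
    rw [auxF_succ, ih, auxF_succ t N n, Nat.choose_succ_succ N (n + 1)]
    push_cast
    ring

theorem auxF_up (t : ℤ) (N n : ℕ) :
    t * auxF t (N + 1) n = (1 + t) * auxF t N n - (N.choose n : ℤ) := by
  cases n with
  | zero => simp [auxF_zero]
  | succ n =>
    rw [auxF_pascal, auxF_succ]
    ring

theorem auxF_eq (t : ℤ) (m n : ℕ) :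
    ∑ j ∈ Finset.range (n + 1), (1 + t) ^ j * ((m + n - j).choose m : ℤ)
      = auxF t (m + n + 1) n := by
  induction n with
  | zero => simp [auxF_zero]
  | succ n ih =>
    rw [← add_assoc m n 1, auxF_pascal, ← ih, Finset.sum_range_succ', Finset.mul_sum]
    congr 1
    · apply Finset.sum_congr rfl
      intro j _
      rw [show m + n + 1 - (j + 1) = m + n - j by omega]
      ring
    · rw [← Nat.choose_symm_of_eq_add (show m + n + 1 = m + (n + 1) by omega)]
      simp

theorem auxF_mid (n : ℕ) : auxF 2 (3 * n + 1) n = auxF (-4) (3 * n + 1) (2 * n) := by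
  induction n with
  | zero => simp [auxF_zero]
  | succ n ih =>
    rw [show 3 * (n + 1) + 1 = 3 * n + 1 + 1 + 1 + 1 by ring,
      show 2 * (n + 1) = 2 * n + 1 + 1 by ring]
    have a1 := auxF_up 2 (3 * n + 1) n
    have a2 := auxF_up 2 (3 * n + 1 + 1) n
    have a3 := auxF_up 2 (3 * n + 1 + 1 + 1) n
    have a4 := auxF_succ 2 (3 * n + 1 + 1 + 1 + 1) n
    have b1 := auxF_pascal (-4) (3 * n + 1) (2 * n)
    have b2 := auxF_pascal (-4) (3 * n + 1 + 1) (2 * n + 1)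
    have b3 := auxF_up (-4) (3 * n + 1 + 1 + 1) (2 * n + 1 + 1)
    rw [Nat.choose_symm_of_eq_add (show 3 * n + 1 = (2 * n + 1) + n by omega)] at b1
    rw [Nat.choose_symm_of_eq_add (show 3 * n + 1 + 1 = (2 * n + 1 + 1) + n by omega)] at b2
    rw [Nat.choose_symm_of_eq_add
      (show 3 * n + 1 + 1 + 1 = (2 * n + 1 + 1) + (n + 1) by omega)] at b3
    have c1 := Nat.choose_succ_succ (3 * n + 1 + 1 + 1) n
    have c2 := Nat.add_one_mul_choose_eq (3 * n + 1 + 1) n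
    have c3 : (3 * n + 1 + 1 + 1).choose (n + 1) = 3 * (3 * n + 1 + 1).choose n := by
      apply Nat.eq_of_mul_eq_mul_right (Nat.succ_pos n)
      rw [Nat.succ_eq_add_one, ← c2]
      ring
    simp only [Nat.succ_eq_add_one] at c1
    zify at c1 c3
    linarith

theorem stmt_8 (n : ℕ) :
    (∑ j ∈ Finset.range (n + 1), (3 : ℤ) ^ j * ((3 * n - j).choose (2 * n) : ℤ)
      = ∑ j ∈ Finset.range (n + 1), (2 : ℤ) ^ j * ((3 * n + 1).choose (n - j) : ℤ)) ∧
    (∑ j ∈ Finset.range (n + 1), (2 : ℤ) ^ j * ((3 * n + 1).choose (n - j) : ℤ)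
      = ∑ j ∈ Finset.range (2 * n + 1), (-4 : ℤ) ^ j * ((3 * n + 1).choose (n + 1 + j) : ℤ)) ∧
    (∑ j ∈ Finset.range (2 * n + 1), (-4 : ℤ) ^ j * ((3 * n + 1).choose (n + 1 + j) : ℤ)
      = ∑ j ∈ Finset.range (2 * n + 1), (-3 : ℤ) ^ j * ((3 * n - j).choose n : ℤ)) := by
  have h3 : ∑ j ∈ Finset.range (2 * n + 1), (-4 : ℤ) ^ j * ((3 * n + 1).choose (n + 1 + j) : ℤ)
      = auxF (-4) (3 * n + 1) (2 * n) := by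
    unfold auxF
    apply Finset.sum_congr rfl
    intro j hj
    have := Finset.mem_range.mp hj
    rw [Nat.choose_symm_of_eq_add (show 3 * n + 1 = (n + 1 + j) + (2 * n - j) by omega)]
  have h1 := auxF_eq 2 (2 * n) n
  have h4 := auxF_eq (-4) n (2 * n)
  rw [show 2 * n + n = 3 * n by ring, show (1 + 2 : ℤ) = 3 by norm_num] at h1
  rw [show n + 2 * n = 3 * n by ring, show (1 + -4 : ℤ) = -3 by norm_num] at h4
  refine ⟨h1, ?_, ?_⟩
  · rw [h3]; exact auxF_mid n
  · rw [h3, h4]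
end

section
/- For every integer n ≥ 0, one has ∑_{j=0}^{n} 3^{j} · C(3n-j, 2n) = ∑_{j=0}^{2n} (-3)^{j} · C(3n-j, n). -/
/-- The coefficient of `x^m` in `1/((1-sx)(1-x)^(a+1))`. -/
def HH (s : ℤ) (a m : ℕ) : ℤ :=
  ∑ j ∈ Finset.range (m + 1), s ^ j * ((a + m - j).choose a : ℤ)

theorem HH_succ (s : ℤ) (a m : ℕ) :
    HH s a (m + 1) = s * HH s a m + ((a + m + 1).choose a : ℤ) := by
  unfold HH
  rw [Finset.sum_range_succ', Finset.mul_sum]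
  congr 1
  · apply Finset.sum_congr rfl
    intro j _
    have : a + (m + 1) - (j + 1) = a + m - j := by omega
    rw [this]
    ring
  · simp [add_assoc]

theorem HH_step (s : ℤ) (a m : ℕ) :
    (s - 1) * HH s (a + 1) m = s * HH s a m - ((a + m + 1).choose (a + 1) : ℤ) := by
  induction m with
  | zero => simp [HH]
  | succ m ih =>
    rw [HH_succ, HH_succ]
    have e1 : a + 1 + m + 1 = a + m + 1 + 1 := by omega
    have e2 : a + (m + 1) + 1 = a + m + 1 + 1 := by omega
    rw [e1, e2, Nat.choose_succ_succ (a + m + 1) a]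
    push_cast
    linear_combination s * ih

theorem HH_main (n : ℕ) : HH 3 (2 * n) n = HH (-3) n (2 * n) := by
  induction n with
  | zero => simp [HH]
  | succ n ih =>
    have a1 := HH_step 3 (2 * n) n
    have a2 := HH_step 3 (2 * n + 1) n
    have a3 := HH_succ 3 (2 * n + 2) n
    have b1 := HH_step (-3) n (2 * n)
    have b2 := HH_succ (-3) (n + 1) (2 * n)
    have b3 := HH_succ (-3) (n + 1) (2 * n + 1)
    have c1 : (2 * n + n + 1).choose (2 * n + 1) = (3 * n + 1).choose n := by
      rw [← Nat.choose_symm_of_eq_add (n := 3 * n + 1) (a := 2 * n + 1) (b := n) (by omega)]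
      congr 1; omega
    have c2 : (2 * n + 1 + n + 1).choose (2 * n + 1 + 1) = (3 * n + 2).choose n := by
      rw [← Nat.choose_symm_of_eq_add (n := 3 * n + 2) (a := 2 * n + 2) (b := n) (by omega)]
      congr 1; omega
    have c3 : (2 * n + 2 + n + 1).choose (2 * n + 2) = (3 * n + 3).choose (n + 1) := by
      rw [← Nat.choose_symm_of_eq_add (n := 3 * n + 3) (a := 2 * n + 2) (b := n + 1) (by omega)]
      congr 1; omega
    have d1 : n + 2 * n + 1 = 3 * n + 1 := by omega
    have d2 : n + 1 + 2 * n + 1 = 3 * n + 2 := by omega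
    have d3 : n + 1 + (2 * n + 1) + 1 = 3 * n + 3 := by omega
    rw [c1] at a1
    rw [c2] at a2
    rw [c3] at a3
    rw [d1] at b1
    rw [d2] at b2
    rw [d3] at b3
    have p : ((3 * n + 2).choose (n + 1) : ℤ) = (3 * n + 1).choose n + (3 * n + 1).choose (n + 1) := by
      exact_mod_cast Nat.choose_succ_succ (3 * n + 1) n
    have q : ((3 * n + 2).choose (n + 1) : ℤ) = 2 * (3 * n + 2).choose n := by
      have h := Nat.choose_succ_right_eq (3 * n + 2) n
      have e : 3 * n + 2 - n = 2 * (n + 1) := by omega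
      rw [e] at h
      have : (3 * n + 2).choose (n + 1) = 2 * (3 * n + 2).choose n := by
        apply Nat.eq_of_mul_eq_mul_right (Nat.succ_pos n)
        rw [Nat.succ_eq_add_one, h]; ring
      exact_mod_cast this
    have g : 2 * (n + 1) = 2 * n + 2 := by ring
    rw [g]
    simp only [add_assoc, Nat.reduceAdd] at *
    linarith

/-- For every `n ≥ 0`, `∑_{j=0}^{n} 3^j C(3n-j,2n) = ∑_{j=0}^{2n} (-3)^j C(3n-j,n)`. -/
theorem stmt_9 (n : ℕ) :
    ∑ j ∈ Finset.range (n + 1), (3 : ℤ) ^ j * ((3 * n - j).choose (2 * n) : ℤ)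
      = ∑ j ∈ Finset.range (2 * n + 1), (-3 : ℤ) ^ j * ((3 * n - j).choose n : ℤ) := by
  have h := HH_main n
  unfold HH at h
  have e1 : 2 * n + n = 3 * n := by ring
  have e2 : n + 2 * n = 3 * n := by ring
  rw [e1, e2] at h
  exact h
end

section
/- For every integer n ≥ 0, one has ∑_{j=0}^{n} 2^{j} · C(3n+1, n-j) = ∑_{j=0}^{2n} (-4)^{j} · C(3n+1, n+1+j). -/
def auxA (N k : ℕ) : ℤ := ∑ j ∈ Finset.range (k + 1), (2 : ℤ) ^ j * (N.choose (k - j) : ℤ)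

def auxB (m k : ℕ) : ℤ :=
  ∑ j ∈ Finset.range m, (-4 : ℤ) ^ j * ((k + m).choose (k + 1 + j) : ℤ)

lemma auxA_succ (N k : ℕ) : auxA N (k + 1) = 2 * auxA N k + (N.choose (k + 1) : ℤ) := by
  unfold auxA
  rw [Finset.sum_range_succ', Finset.mul_sum]
  congr 1
  · apply Finset.sum_congr rfl
    intro j _
    rw [Nat.add_sub_add_right, pow_succ]
    ring
  · simp

lemma auxA_pascal (N k : ℕ) : auxA (N + 1) (k + 1) = auxA N (k + 1) + auxA N k := by
  induction k with
  | zero =>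
    simp [auxA, Finset.sum_range_succ]
    ring
  | succ k ih =>
    rw [auxA_succ (N + 1), ih, auxA_succ N (k + 1), Nat.choose_succ_succ]
    push_cast
    linarith [auxA_succ N k]

lemma auxA_step (N k : ℕ) :
    2 * auxA (N + 1) (k + 1) = 3 * auxA N (k + 1) - (N.choose (k + 1) : ℤ) := by
  linarith [auxA_pascal N k, auxA_succ N k]

lemma auxB_succ (m k : ℕ) :
    auxB (m + 1) k = ((k + m + 1).choose (k + 1) : ℤ) - 4 * auxB m (k + 1) := by
  unfold auxB
  rw [Finset.sum_range_succ', sub_eq_add_neg, add_comm, ← neg_mul, Finset.mul_sum]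
  congr 1
  · simp [add_assoc]
  · apply Finset.sum_congr rfl
    intro j _
    rw [show k + (m + 1) = k + 1 + m by ring, show k + 1 + (j + 1) = k + 1 + 1 + j by ring, pow_succ]
    ring

lemma auxB_pascal (m k : ℕ) :
    auxB (m + 1) (k + 1) = auxB (m + 1) k + auxB m (k + 1) := by
  have h : auxB m (k + 1) = ∑ j ∈ Finset.range (m + 1),
      (-4 : ℤ) ^ j * ((k + 1 + m).choose (k + 1 + 1 + j) : ℤ) := by
    rw [Finset.sum_range_succ, Nat.choose_eq_zero_of_lt (by omega : k + 1 + m < k + 1 + 1 + m)]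
    simp [auxB]
  rw [h]
  unfold auxB
  rw [← Finset.sum_add_distrib]
  apply Finset.sum_congr rfl
  intro j _
  rw [show k + 1 + (m + 1) = (k + 1 + m) + 1 by ring,
    show k + 1 + 1 + j = (k + 1 + j) + 1 by ring, Nat.choose_succ_succ,
    show k + (m + 1) = k + 1 + m by ring]
  push_cast
  ring

lemma auxB_step (m k : ℕ) :
    auxB (m + 1) (k + 1) = ((k + m + 1).choose (k + 1) : ℤ) - 3 * auxB m (k + 1) := by
  linarith [auxB_pascal m k, auxB_succ m k]

lemma aux_main_s10 (n : ℕ) : auxA (3 * n + 1) n = auxB (2 * n + 1) n := by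
  induction n with
  | zero => simp [auxA, auxB]
  | succ n ih =>
    have a1 := auxA_step (3 * n + 1) n
    have a2 := auxA_step (3 * n + 2) n
    have a3 := auxA_step (3 * n + 3) n
    have a0 := auxA_succ (3 * n + 1) n
    have b1 := auxB_step (2 * n) n
    have b2 := auxB_step (2 * n + 1) n
    have b3 := auxB_step (2 * n + 2) n
    have b0 := auxB_succ (2 * n) n
    rw [show n + 2 * n + 1 = 3 * n + 1 by ring] at b0 b1
    rw [show n + (2 * n + 1) + 1 = 3 * n + 2 by ring] at b2
    rw [show n + (2 * n + 2) + 1 = 3 * n + 3 by ring] at b3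
    have c := Nat.choose_mul_succ_eq (3 * n + 2) (n + 1)
    rw [show 3 * n + 2 + 1 - (n + 1) = 2 * (n + 1) by omega] at c
    have c' : 3 * ((3 * n + 2).choose (n + 1) : ℤ) = 2 * ((3 * n + 3).choose (n + 1) : ℤ) := by
      have hn : ((n : ℤ) + 1) ≠ 0 := by positivity
      apply mul_left_cancel₀ hn
      have c2 : (((3 * n + 2).choose (n + 1) : ℤ)) * (3 * n + 2 + 1)
          = ((3 * n + 3).choose (n + 1) : ℤ) * (2 * (n + 1)) := by exact_mod_cast c
      linarith
    rw [show 3 * (n + 1) + 1 = 3 * n + 3 + 1 by ring,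
      show 2 * (n + 1) + 1 = 2 * n + 2 + 1 by ring]
    simp only [add_assoc, Nat.reduceAdd] at *
    linarith

/-- For every `n ≥ 0`, `∑_{j=0}^{n} 2^j C(3n+1,n-j) = ∑_{j=0}^{2n} (-4)^j C(3n+1,n+1+j)`. -/
theorem stmt_10 (n : ℕ) :
    ∑ j ∈ Finset.range (n + 1), (2 : ℤ) ^ j * ((3 * n + 1).choose (n - j) : ℤ)
      = ∑ j ∈ Finset.range (2 * n + 1), (-4 : ℤ) ^ j * ((3 * n + 1).choose (n + 1 + j) : ℤ) := by
  have h := aux_main_s10 n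
  unfold auxA auxB at h
  rw [show n + (2 * n + 1) = 3 * n + 1 by ring] at h
  exact h
end

section
/- Let n ≥ 1 and a ≥ 1 be integers, and let p be a real number with 0 < p ≤ 1. Then the series ∑_{s=a}^{∞} C(n+s-1, s) · p^{n} · (1-p)^{s} converges and its sum equals (∫_{0}^{1-p} t^{a-1} (1-t)^{n-1} dt) / (∫_{0}^{1} t^{a-1} (1-t)^{n-1} dt). -/
lemma head_deriv (m b : ℕ) (x : ℝ) :
    HasDerivAt (fun x : ℝ => ∑ s ∈ Finset.range (b + 1),
        ((m + s).choose s : ℝ) * (1 - x) ^ (m + 1) * x ^ s)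
      (-(((b + 1 : ℕ) : ℝ) * ((m + b + 1).choose (b + 1) : ℝ)) * (x ^ b * (1 - x) ^ m)) x := by
  have h1 : HasDerivAt (fun x : ℝ => (1 - x) ^ (m + 1)) (-(((m + 1 : ℕ) : ℝ) * (1 - x) ^ m)) x := by
    have := ((hasDerivAt_id x).const_sub 1).pow (m + 1)
    convert! this using 1
    simp
  induction b with
  | zero => 
    convert! h1 using 1
    · ext y; simp
    · simp; ring
  | succ b ih =>
    have h2 := (h1.const_mul ((m + (b + 1)).choose (b + 1) : ℝ)).mul (hasDerivAt_pow (b + 1) x)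
    have h3 := ih.add h2
    convert! h3 using 1
    · ext y
      simp only [Pi.add_apply, Pi.mul_apply]
      rw [Finset.sum_range_succ]
    · have hc : (((b + 1 + 1 : ℕ) : ℝ) * ((m + (b + 1) + 1).choose (b + 1 + 1) : ℝ))
          = ((m + (b + 1) + 1 : ℕ) : ℝ) * ((m + (b + 1)).choose (b + 1) : ℝ) := by
        have := Nat.add_one_mul_choose_eq (m + (b + 1)) (b + 1)
        rw [mul_comm]
        exact_mod_cast this.symm
      rw [hc]
      simp only [← add_assoc, Nat.add_sub_cancel]
      push_cast
      ring

lemma head_integral (m b : ℕ) (x : ℝ) :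
    (((b + 1 : ℕ) : ℝ) * ((m + b + 1).choose (b + 1) : ℝ)) *
      (∫ t in (0 : ℝ)..x, t ^ b * (1 - t) ^ m) =
    1 - ∑ s ∈ Finset.range (b + 1), ((m + s).choose s : ℝ) * (1 - x) ^ (m + 1) * x ^ s := by
  have h := intervalIntegral.integral_eq_sub_of_hasDerivAt (a := 0) (b := x)
    (fun y _ => head_deriv m b y) (Continuous.intervalIntegrable (by fun_prop) _ _)
  rw [intervalIntegral.integral_const_mul] at h
  have h0 : ∑ s ∈ Finset.range (b + 1),
      ((m + s).choose s : ℝ) * (1 - (0:ℝ)) ^ (m + 1) * (0:ℝ) ^ s = 1 := by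
    rw [Finset.sum_range_succ']; simp
  rw [h0] at h
  linarith


/-- Negative binomial tail as regularized incomplete beta function: for `n ≥ 1`, `a ≥ 1`
and `0 < p ≤ 1`, the series `∑_{s=a}^{∞} C(n+s-1,s) p^n (1-p)^s` converges, with sum
`(∫_0^{1-p} t^{a-1}(1-t)^{n-1} dt) / (∫_0^1 t^{a-1}(1-t)^{n-1} dt)`. -/
theorem stmt_12 (n a : ℕ) (hn : 1 ≤ n) (ha : 1 ≤ a)
    (p : ℝ) (hp0 : 0 < p) (hp1 : p ≤ 1) :
    HasSum (fun j : ℕ => ((n + (a + j) - 1).choose (a + j) : ℝ) * p ^ n * (1 - p) ^ (a + j))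
      ((∫ t in (0 : ℝ)..(1 - p), t ^ (a - 1) * (1 - t) ^ (n - 1)) /
       (∫ t in (0 : ℝ)..1, t ^ (a - 1) * (1 - t) ^ (n - 1))) := by

  obtain ⟨m, rfl⟩ : ∃ m, n = m + 1 := ⟨n - 1, by omega⟩
  obtain ⟨b, rfl⟩ : ∃ b, a = b + 1 := ⟨a - 1, by omega⟩
  simp only [Nat.add_sub_cancel]
  have hI := head_integral m b (1 - p)
  have h1 := head_integral m b 1
  have hK : (0:ℝ) < ((b + 1 : ℕ) : ℝ) * ((m + b + 1).choose (b + 1) : ℝ) := by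
    have := Nat.choose_pos (show b + 1 ≤ m + b + 1 by omega)
    positivity
  generalize ((b + 1 : ℕ) : ℝ) * ((m + b + 1).choose (b + 1) : ℝ) = K at hI h1 hK
  simp only [sub_self, sub_sub_cancel] at hI h1
  have h1' : K * (∫ t in (0 : ℝ)..1, t ^ b * (1 - t) ^ m) = 1 := by
    rw [h1]; simp
  rw [← mul_div_mul_left _ _ hK.ne', h1', div_one, hI]
  have hx : ‖1 - p‖ < 1 := by
    rw [Real.norm_eq_abs, abs_lt]; constructor <;> linarith
  have hs : HasSum (fun s : ℕ => ((m + s).choose s : ℝ) * p ^ (m + 1) * (1 - p) ^ s) 1 := by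
    have h := (hasSum_choose_mul_geometric_of_norm_lt_one m hx).mul_left (p ^ (m + 1))
    convert! h using 1
    · ext s
      rw [add_comm m s, Nat.choose_symm_add]; ring
    · rw [sub_sub_cancel]; field_simp
  have h2 := (hasSum_nat_add_iff' (b + 1)).mpr hs
  convert! h2 using 1
  ext j
  rw [show m + 1 + (b + 1 + j) - 1 = m + (j + (b + 1)) by omega, add_comm (b + 1) j]
end

section
/- For every integer n ≥ 0 and every real number x, one has ∑_{j=0}^{n} C(3n-j, 2n) · (x+1)^{j} = ∑_{j=0}^{n} C(3n+1, n-j) · x^{j}. (That is, with A_n(x) = ∑_{j=0}^{n} C(3n-j,2n) x^j and B_n(x) = ∑_{j=0}^{n} C(3n+1,n-j) x^j, one has A_n(x+1) = B_n(x).) -/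
theorem stmt_14_aux (k m : ℕ) (x : ℝ) :
    ∑ j ∈ Finset.range (m + 1), ((m + k - j).choose k : ℝ) * (x + 1) ^ j
      = ∑ j ∈ Finset.range (m + 1), ((m + k + 1).choose (m - j) : ℝ) * x ^ j := by
  induction m with
  | zero => simp
  | succ m ih =>
    have hL : ∑ j ∈ Finset.range (m + 1 + 1), ((m + 1 + k - j).choose k : ℝ) * (x + 1) ^ j
        = (x + 1) * (∑ j ∈ Finset.range (m + 1), ((m + k - j).choose k : ℝ) * (x + 1) ^ j)
          + ((m + k + 1).choose (m + 1) : ℝ) := by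
      rw [Finset.sum_range_succ', Finset.mul_sum]
      congr 1
      · refine Finset.sum_congr rfl fun j _ => ?_
        rw [show m + 1 + k - (j + 1) = m + k - j by omega]
        ring
      · rw [show m + 1 + k - 0 = m + k + 1 by omega,
          Nat.choose_symm_of_eq_add (show m + k + 1 = k + (m + 1) by omega)]
        simp
    have hS : ∑ j ∈ Finset.range (m + 1 + 1), ((m + k + 1).choose (m + 1 - j) : ℝ) * x ^ j
        = x * (∑ j ∈ Finset.range (m + 1), ((m + k + 1).choose (m - j) : ℝ) * x ^ j)
          + ((m + k + 1).choose (m + 1) : ℝ) := by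
      rw [Finset.sum_range_succ', Finset.mul_sum]
      congr 1
      · refine Finset.sum_congr rfl fun j _ => ?_
        rw [show m + 1 - (j + 1) = m - j by omega]
        ring
      · simp
    have hR : ∑ j ∈ Finset.range (m + 1 + 1), ((m + 1 + k + 1).choose (m + 1 - j) : ℝ) * x ^ j
        = ∑ j ∈ Finset.range (m + 1 + 1), ((m + k + 1).choose (m + 1 - j) : ℝ) * x ^ j
          + ∑ j ∈ Finset.range (m + 1), ((m + k + 1).choose (m - j) : ℝ) * x ^ j := by
      rw [Finset.sum_range_succ, Finset.sum_range_succ _ (m + 1), add_right_comm (Finset.sum _ _),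
        ← Finset.sum_add_distrib]
      congr 1
      · refine Finset.sum_congr rfl fun j hj => ?_
        have hj' : j < m + 1 := Finset.mem_range.mp hj
        rw [show m + 1 - j = (m - j) + 1 by omega, show m + 1 + k + 1 = (m + k + 1) + 1 by omega,
          Nat.choose_succ_succ (m + k + 1)]
        push_cast
        ring
      · simp
    rw [hL, hR, hS, ih]
    ring

/-- `A_n(x+1) = B_n(x)`: for every `n ≥ 0` and real `x`,
`∑_{j=0}^{n} C(3n-j,2n) (x+1)^j = ∑_{j=0}^{n} C(3n+1,n-j) x^j`. -/
theorem stmt_14 (n : ℕ) (x : ℝ) :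
    ∑ j ∈ Finset.range (n + 1), ((3 * n - j).choose (2 * n) : ℝ) * (x + 1) ^ j
      = ∑ j ∈ Finset.range (n + 1), ((3 * n + 1).choose (n - j) : ℝ) * x ^ j := by
  have h := stmt_14_aux (2 * n) n x
  rwa [show n + 2 * n = 3 * n by omega] at h
end

section
/- For every integer n ≥ 0 and every real number x, one has ∑_{j=0}^{2n} C(3n-j, n) · (x+1)^{j} = ∑_{j=0}^{2n} C(3n+1, n+1+j) · x^{j}. (That is, with C_n(x) = ∑_{j=0}^{2n} C(3n-j,n) x^j and D_n(x) = ∑_{j=0}^{2n} C(3n+1,n+1+j) x^j, one has C_n(x+1) = D_n(x).) -/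
theorem aux_gen (n m : ℕ) (x : ℝ) :
    ∑ j ∈ Finset.range (m + 1), ((n + m - j).choose n : ℝ) * (x + 1) ^ j
      = ∑ j ∈ Finset.range (m + 1), ((n + m + 1).choose (n + 1 + j) : ℝ) * x ^ j := by
  induction m with
  | zero => simp
  | succ m ih =>
    have hL : ∑ j ∈ Finset.range (m + 1 + 1), ((n + (m + 1) - j).choose n : ℝ) * (x + 1) ^ j
        = (x + 1) * ∑ j ∈ Finset.range (m + 1), ((n + m - j).choose n : ℝ) * (x + 1) ^ j
          + ((n + m + 1).choose n : ℝ) := by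
      rw [Finset.sum_range_succ', Finset.mul_sum]
      congr 1
      · apply Finset.sum_congr rfl
        intro j _
        rw [show n + (m + 1) - (j + 1) = n + m - j by omega]
        ring
      · simp [add_assoc]
    have hP : ∀ j, ((n + (m + 1) + 1).choose (n + 1 + j) : ℝ) * x ^ j
        = ((n + m + 1).choose (n + j) : ℝ) * x ^ j
          + ((n + m + 1).choose (n + 1 + j) : ℝ) * x ^ j := by
      intro j
      rw [show n + (m + 1) + 1 = (n + m + 1) + 1 by ring, show n + 1 + j = (n + j) + 1 by ring,
        Nat.choose_succ_succ]
      push_cast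
      ring
    rw [hL, ih, Finset.sum_congr rfl (fun j _ => hP j), Finset.sum_add_distrib,
      Finset.sum_range_succ' (fun j => ((n + m + 1).choose (n + j) : ℝ) * x ^ j),
      Finset.sum_range_succ (fun j => ((n + m + 1).choose (n + 1 + j) : ℝ) * x ^ j) (m + 1),
      Nat.choose_eq_zero_of_lt (show n + m + 1 < n + 1 + (m + 1) by omega)]
    have h1 : ∑ j ∈ Finset.range (m + 1), ((n + m + 1).choose (n + (j + 1)) : ℝ) * x ^ (j + 1)
        = x * ∑ j ∈ Finset.range (m + 1), ((n + m + 1).choose (n + 1 + j) : ℝ) * x ^ j := by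
      rw [Finset.mul_sum]
      apply Finset.sum_congr rfl
      intro j _
      rw [show n + (j + 1) = n + 1 + j by ring]
      ring
    rw [h1]
    simp only [add_zero, pow_zero, Nat.cast_zero]
    ring

/-- `C_n(x+1) = D_n(x)`: for every `n ≥ 0` and real `x`,
`∑_{j=0}^{2n} C(3n-j,n) (x+1)^j = ∑_{j=0}^{2n} C(3n+1,n+1+j) x^j`. -/
theorem stmt_15 (n : ℕ) (x : ℝ) :
    ∑ j ∈ Finset.range (2 * n + 1), ((3 * n - j).choose n : ℝ) * (x + 1) ^ j
      = ∑ j ∈ Finset.range (2 * n + 1), ((3 * n + 1).choose (n + 1 + j) : ℝ) * x ^ j := by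
  have h := aux_gen n (2 * n) x
  rw [show n + 2 * n = 3 * n by ring] at h
  exact h
end
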